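/- arXiv:1507.04324 — 2 statements merged into one kernel-verified Lean document; each statement's English description precedes it below -/
import Mathlib

section
/- For 0 < α ≤ 1, the Mittag-Leffler function E_α(t) := ∑_{j=0}^∞ t^j / Γ(jα+1) satisfies E_α(t) > 0 for all t ∈ ℝ. -/
/-- The Mittag-Leffler function `E_α(t) = ∑ t^j / Γ(jα+1)`. -/
noncomputable def mittagLeffler (α : ℝ) (t : ℝ) : ℝ :=
  ∑' j : ℕ, t ^ j / Real.Gamma (j * α + 1)

open Finset Filter Topology

/-- Euler's finite product `n ^ (-y) * ∏_{k = 1}^n (y + k) / n!`, which tends to `1 / Γ(y + 1)`. -/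
noncomputable def eulerProd (n : ℕ) (y : ℝ) : ℝ :=
  (∏ k ∈ range n, (y + (k + 1))) / (n.factorial : ℝ) * (n : ℝ) ^ (-y)

lemma eulerProd_nonneg (n : ℕ) {y : ℝ} (hy : 0 ≤ y) : 0 ≤ eulerProd n y := by
  unfold eulerProd
  have : 0 ≤ ∏ k ∈ range n, (y + (k + 1)) := prod_nonneg fun k _ => by positivity
  positivity

lemma tendsto_eulerProd {y : ℝ} (hy : 0 ≤ y) :
    Tendsto (fun n => eulerProd n y) atTop (𝓝 (1 / Real.Gamma (y + 1))) := by
  rcases hy.eq_or_lt with rfl | hy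
  · have h (n : ℕ) : eulerProd n 0 = 1 := by
      have hn : (n.factorial : ℝ) ≠ 0 := by positivity
      have hp : ∏ k ∈ range n, ((0 : ℝ) + (k + 1)) = n.factorial := by
        rw [← prod_range_add_one_eq_factorial]
        push_cast
        simp
      rw [eulerProd, hp]
      simp [hn]
    simp [h]
  · have hG : Real.Gamma y ≠ 0 := (Real.Gamma_pos_of_pos hy).ne'
    rw [Real.Gamma_add_one hy.ne']
    have h := ((Real.GammaSeq_tendsto_Gamma y).const_mul y).inv₀ (mul_ne_zero hy.ne' hG)
    rw [one_div]
    refine h.congr' ?_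
    filter_upwards [eventually_gt_atTop 0] with n hn
    have hn' : (0 : ℝ) < n := by exact_mod_cast hn
    have hp : 0 < ∏ k ∈ range n, (y + (k + 1)) := prod_pos fun k _ => by positivity
    have hq : 0 < (n : ℝ) ^ y := Real.rpow_pos_of_pos hn' y
    rw [eulerProd, Real.GammaSeq, prod_range_succ', Real.rpow_neg hn'.le]
    push_cast
    field_simp
    simp

lemma eulerProd_succ_le {n : ℕ} (hn : 0 < n) {y : ℝ} (hy : 0 ≤ y) :
    eulerProd (n + 1) y ≤ eulerProd n y := by
  have hn' : (0 : ℝ) < n := by exact_mod_cast hn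
  have hq : 0 < (n : ℝ) ^ y := Real.rpow_pos_of_pos hn' y
  have hq' : 0 < ((n : ℝ) + 1) ^ y := Real.rpow_pos_of_pos (by positivity) y
  have hle : (1 + y / (n + 1)) * ((n : ℝ) / (n + 1)) ^ y ≤ 1 := by
    have h1 : 1 + y / ((n : ℝ) + 1) ≤ Real.exp (y / (n + 1)) := by
      linarith [Real.add_one_le_exp (y / ((n : ℝ) + 1))]
    have h2 : (n : ℝ) / (n + 1) ≤ Real.exp (-(1 / (n + 1))) := by
      have := Real.add_one_le_exp (-(1 / ((n : ℝ) + 1)))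
      have e : (n : ℝ) / (n + 1) = -(1 / (n + 1)) + 1 := by field_simp; ring
      rwa [e]
    have h3 : ((n : ℝ) / (n + 1)) ^ y ≤ Real.exp (-(y / (n + 1))) := by
      refine (Real.rpow_le_rpow (by positivity) h2 hy).trans_eq ?_
      rw [← Real.exp_mul]
      congr 1
      ring
    calc _ ≤ Real.exp (y / (n + 1)) * Real.exp (-(y / (n + 1))) := by gcongr
      _ = 1 := by rw [← Real.exp_add]; simp
  have heq : eulerProd (n + 1) y =
      eulerProd n y * ((1 + y / (n + 1)) * ((n : ℝ) / (n + 1)) ^ y) := by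
    rw [eulerProd, eulerProd, prod_range_succ, Nat.factorial_succ,
      Real.div_rpow hn'.le (by positivity), Real.rpow_neg hn'.le, Real.rpow_neg (by positivity)]
    push_cast
    field_simp
    ring
  rw [heq]
  exact mul_le_of_le_one_right (eulerProd_nonneg n hy) hle

lemma eulerProd_le {N n : ℕ} (hN : 0 < N) (h : N ≤ n) {y : ℝ} (hy : 0 ≤ y) :
    eulerProd n y ≤ eulerProd N y := by
  induction n, h using Nat.le_induction with
  | base => exact le_rfl
  | succ n hn ih => exact (eulerProd_succ_le (hN.trans_le hn) hy).trans ih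

lemma one_div_Gamma_le_eulerProd {N : ℕ} (hN : 0 < N) {y : ℝ} (hy : 0 ≤ y) :
    1 / Real.Gamma (y + 1) ≤ eulerProd N y :=
  le_of_tendsto (tendsto_eulerProd hy) <| by
    filter_upwards [eventually_ge_atTop N] with n hn using eulerProd_le hN hn hy

/-- For `α ≤ 1`, the polynomial `∏_{k = 1}^n (α j + k)` in `j` has nonnegative coefficients in the
basis of the binomial polynomials `(j + m).choose m`. -/
lemma exists_prod_eq_sum_choose {α : ℝ} (hα : 0 ≤ α) (hα1 : α ≤ 1) (n : ℕ) :
    ∃ a : ℕ → ℝ, (∀ m, 0 ≤ a m) ∧ ∀ j : ℕ, ∏ k ∈ range n, (j * α + (k + 1)) =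
      ∑ m ∈ range (n + 1), a m * ((j + m).choose m : ℝ) := by
  induction n with
  | zero => exact ⟨fun _ => 1, fun _ => zero_le_one, by simp⟩
  | succ n ih =>
    obtain ⟨a, ha, h⟩ := ih
    refine ⟨fun m => (if m ≤ n then (n + 1 - α * (m + 1)) * a m else 0) + α * m * a (m - 1),
      fun m => ?_, fun j => ?_⟩
    · have h1 : 0 ≤ α * m * a (m - 1) := by have := ha (m - 1); positivity
      refine add_nonneg ?_ h1
      split_ifs with hm
      · refine mul_nonneg ?_ (ha m)
        have hm' : (m : ℝ) ≤ n := by exact_mod_cast hm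
        nlinarith
      · exact le_rfl
    · have hstep (m : ℕ) : ((j : ℝ) + m + 1) * ((j + m).choose m : ℝ) =
          (m + 1) * ((j + (m + 1)).choose (m + 1) : ℝ) := by
        have := Nat.add_one_mul_choose_eq (j + m) m
        rw [mul_comm ((m : ℝ) + 1)]
        exact_mod_cast this
      simp only [add_mul, sum_add_distrib]
      rw [prod_range_succ, h, sum_range_succ _ (n + 1), sum_range_succ' _ (n + 1)]
      simp only [Nat.cast_zero, mul_zero, zero_mul, add_zero, Nat.add_sub_cancel]
      rw [if_neg (by omega), zero_mul, add_zero, sum_mul, ← sum_add_distrib]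
      refine sum_congr rfl fun m hm => ?_
      rw [if_pos (by simpa [Nat.lt_succ_iff] using hm)]
      push_cast
      linear_combination α * a m * hstep m

/-- The approximant of the Mittag-Leffler series is a power series in `t * n ^ (-α)`. -/
lemma pow_mul_eulerProd (n : ℕ) (α t : ℝ) (j : ℕ) :
    t ^ j * eulerProd n (j * α) =
      (∏ k ∈ range n, (j * α + (k + 1))) / (n.factorial : ℝ) * (t * (n : ℝ) ^ (-α)) ^ j := by
  have : (n : ℝ) ^ (-(j * α)) = ((n : ℝ) ^ (-α)) ^ j := by
    rw [← Real.rpow_mul_natCast (by positivity)]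
    congr 1
    ring
  rw [eulerProd, this, mul_pow]
  ring

lemma hasSum_sum_choose_mul_geometric (a : ℕ → ℝ) (n : ℕ) {r : ℝ} (hr : |r| < 1) :
    HasSum (fun j : ℕ => (∑ m ∈ range n, a m * ((j + m).choose m : ℝ)) * r ^ j)
      (∑ m ∈ range n, a m * (1 / (1 - r) ^ (m + 1))) := by
  simp only [sum_mul, mul_assoc]
  exact hasSum_sum fun m _ =>
    (hasSum_choose_mul_geometric_of_norm_lt_one m (r := r) hr).mul_left (a m)

lemma summable_pow_mul_eulerProd {α : ℝ} (hα : 0 ≤ α) (hα1 : α ≤ 1) (n : ℕ) {t : ℝ}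
    (ht : |t * (n : ℝ) ^ (-α)| < 1) : Summable fun j : ℕ => t ^ j * eulerProd n (j * α) := by
  obtain ⟨a, -, h⟩ := exists_prod_eq_sum_choose hα hα1 n
  simp only [pow_mul_eulerProd, h, div_mul_eq_mul_div]
  exact (hasSum_sum_choose_mul_geometric a (n + 1) ht).summable.div_const _

lemma exp_le_tsum_eulerProd {α : ℝ} (hα : 0 ≤ α) (hα1 : α ≤ 1) (n : ℕ) {x : ℝ} (hx : 0 ≤ x)
    (hxn : x * (n : ℝ) ^ (-α) < 1) :
    Real.exp (-(x * eulerProd n α)) ≤ ∑' j : ℕ, (-x) ^ j * eulerProd n (j * α) := by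
  obtain ⟨a, ha, h⟩ := exists_prod_eq_sum_choose hα hα1 n
  set r : ℝ := x * (n : ℝ) ^ (-α) with hr
  have hr0 : 0 ≤ r := by positivity
  have hn : (0 : ℝ) < n.factorial := by positivity
  have hsum := (hasSum_sum_choose_mul_geometric a (n + 1) (r := -r)
    (by rwa [abs_neg, abs_of_nonneg hr0])).div_const (n.factorial : ℝ)
  have hterm (j : ℕ) : (-x) ^ j * eulerProd n (j * α) =
      (∑ m ∈ range (n + 1), a m * ((j + m).choose m : ℝ)) * (-r) ^ j / n.factorial := by
    rw [pow_mul_eulerProd, h, neg_mul, ← hr]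
    ring
  simp only [hterm]
  rw [hsum.tsum_eq]
  have h0 : ∑ m ∈ range (n + 1), a m = n.factorial := by
    have := h 0
    simp only [zero_add, Nat.choose_self, Nat.cast_one, mul_one, Nat.cast_zero, zero_mul] at this
    rw [← this, ← prod_range_add_one_eq_factorial]
    push_cast
    rfl
  have h1 : ∑ m ∈ range (n + 1), a m * (r * (m + 1)) = x * eulerProd n α * n.factorial := by
    have h1' := h 1
    have h2 := pow_mul_eulerProd n α x 1
    simp only [pow_one, Nat.cast_one, one_mul] at h1' h2
    rw [h2, h1', ← hr, sum_div, sum_mul, sum_mul]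
    refine sum_congr rfl fun m _ => ?_
    rw [add_comm 1 m, Nat.choose_succ_self_right]
    push_cast
    field_simp
  set c : ℝ := x * eulerProd n α
  rw [le_div_iff₀ hn]
  calc Real.exp (-c) * n.factorial
      = ∑ m ∈ range (n + 1), a m * (Real.exp (-c) * (1 + c - r * (m + 1))) := by
        have e (m : ℕ) : a m * (Real.exp (-c) * (1 + c - r * (m + 1))) =
            Real.exp (-c) * (1 + c) * a m - Real.exp (-c) * (a m * (r * (m + 1))) := by ring
        simp only [e, sum_sub_distrib, ← mul_sum]
        rw [h0, h1]
        ring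
    _ ≤ ∑ m ∈ range (n + 1), a m * (1 / (1 - -r) ^ (m + 1)) := by
        refine sum_le_sum fun m _ => mul_le_mul_of_nonneg_left ?_ (ha m)
        calc Real.exp (-c) * (1 + c - r * (m + 1))
            ≤ Real.exp (-c) * Real.exp (c - r * (m + 1)) := by
              gcongr
              linarith [Real.add_one_le_exp (c - r * (m + 1))]
          _ = 1 / Real.exp r ^ (m + 1) := by
              rw [← Real.exp_add, ← Real.exp_nat_mul, one_div, ← Real.exp_neg]
              congr 1
              push_cast
              ring
          _ ≤ 1 / (1 - -r) ^ (m + 1) := by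
              have : 1 - -r ≤ Real.exp r := by linarith [Real.add_one_le_exp r]
              have : 0 < 1 - -r := by linarith
              gcongr

lemma eventually_mul_rpow_neg_lt_one {α : ℝ} (hα : 0 < α) (x : ℝ) :
    ∀ᶠ n : ℕ in atTop, x * (n : ℝ) ^ (-α) < 1 := by
  have h := ((tendsto_rpow_neg_atTop hα).comp tendsto_natCast_atTop_atTop).const_mul x
  rw [mul_zero] at h
  exact h.eventually_lt_const one_pos

lemma exists_abs_mul_rpow_neg_lt_one {α : ℝ} (hα : 0 < α) (x : ℝ) :
    ∃ N : ℕ, 0 < N ∧ abs (|x| * (N : ℝ) ^ (-α)) < 1 := by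
  obtain ⟨N, hN, hN0⟩ :=
    ((eventually_mul_rpow_neg_lt_one hα |x|).and (eventually_gt_atTop 0)).exists
  exact ⟨N, hN0, by rwa [abs_of_nonneg (by positivity)]⟩

lemma summable_mittagLeffler {α : ℝ} (hα : 0 < α) (hα1 : α ≤ 1) (t : ℝ) :
    Summable fun j : ℕ => t ^ j / Real.Gamma (j * α + 1) := by
  obtain ⟨N, hN0, hN⟩ := exists_abs_mul_rpow_neg_lt_one hα t
  refine (summable_pow_mul_eulerProd hα.le hα1 N hN).of_norm_bounded fun j => ?_
  have hG : 0 < Real.Gamma (j * α + 1) := Real.Gamma_pos_of_pos (by positivity)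
  rw [norm_div, norm_pow, Real.norm_eq_abs, Real.norm_of_nonneg hG.le, div_eq_mul_one_div]
  gcongr
  exact one_div_Gamma_le_eulerProd hN0 (by positivity)

lemma tendsto_tsum_eulerProd {α : ℝ} (hα : 0 < α) (hα1 : α ≤ 1) (t : ℝ) :
    Tendsto (fun n => ∑' j : ℕ, t ^ j * eulerProd n (j * α)) atTop (𝓝 (mittagLeffler α t)) := by
  obtain ⟨N, hN0, hN⟩ := exists_abs_mul_rpow_neg_lt_one hα t
  refine tendsto_tsum_of_dominated_convergence (summable_pow_mul_eulerProd hα.le hα1 N hN)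
    (fun j => ?_) ?_
  · rw [div_eq_mul_one_div]
    exact (tendsto_eulerProd (by positivity)).const_mul _
  · filter_upwards [eventually_ge_atTop N] with n hn j
    have hj : 0 ≤ j * α := by positivity
    rw [norm_mul, norm_pow, Real.norm_eq_abs, Real.norm_of_nonneg (eulerProd_nonneg n hj)]
    gcongr
    exact eulerProd_le hN0 hn hj

lemma exp_le_mittagLeffler_neg {α : ℝ} (hα : 0 < α) (hα1 : α ≤ 1) {x : ℝ} (hx : 0 ≤ x) :
    Real.exp (-(x * (1 / Real.Gamma (α + 1)))) ≤ mittagLeffler α (-x) := by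
  refine le_of_tendsto_of_tendsto
    ((Real.continuous_exp.tendsto _).comp ((tendsto_eulerProd hα.le).const_mul x).neg)
    (tendsto_tsum_eulerProd hα hα1 (-x)) ?_
  filter_upwards [eventually_mul_rpow_neg_lt_one hα x] with n hn
  exact exp_le_tsum_eulerProd hα.le hα1 n hx hn

/-- For `0 < α ≤ 1`, the Mittag-Leffler function is everywhere positive. -/
theorem mittagLeffler_pos (α : ℝ) (hα : 0 < α) (hα1 : α ≤ 1) :
    ∀ t : ℝ, 0 < mittagLeffler α t := by
  intro t
  rcases le_total 0 t with ht | ht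
  · refine (summable_mittagLeffler hα hα1 t).tsum_pos (fun j => ?_) 0 (by simp)
    have hG : 0 < Real.Gamma (j * α + 1) := Real.Gamma_pos_of_pos (by positivity)
    positivity
  · rw [← neg_neg t]
    exact (Real.exp_pos _).trans_le (exp_le_mittagLeffler_neg hα hα1 (neg_nonneg.mpr ht))
end

section
/- For 0 < α ≤ 1, the derivative of the Mittag-Leffler function satisfies E_α'(t) > 0 for all t ∈ ℝ, i.e., E_α is strictly increasing on ℝ. -/
open Filter Topology

/-- The coefficient of `z ^ n` in `(1 - z) ^ (-β)`. -/
noncomputable def risingCoeff (β : ℝ) (n : ℕ) : ℝ :=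
  ∏ i ∈ Finset.range n, (β + i) / (i + 1)

lemma risingCoeff_succ (β : ℝ) (n : ℕ) :
    risingCoeff β (n + 1) = risingCoeff β n * ((β + n) / (n + 1)) :=
  Finset.prod_range_succ _ _

@[simp]
lemma risingCoeff_zero_right (β : ℝ) : risingCoeff β 0 = 1 := rfl

lemma risingCoeff_nonneg {β : ℝ} (hβ : 0 ≤ β) (n : ℕ) : 0 ≤ risingCoeff β n :=
  Finset.prod_nonneg fun _ _ => by positivity

lemma risingCoeff_eq_choose (β : ℝ) (n : ℕ) :
    risingCoeff β n = (-1) ^ n * Ring.choose (-β) n := by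
  rw [Ring.choose_neg', Int.negOnePow_def, Units.smul_def]
  have h := Ring.factorial_nsmul_multichoose_eq_ascPochhammer β n
  have h2 : (n.factorial : ℝ) * risingCoeff β n = (n.factorial : ℝ) * Ring.multichoose β n := by
    rw [← nsmul_eq_mul n.factorial (Ring.multichoose β n), h,
      Polynomial.ascPochhammer_smeval_eq_eval]
    induction n with
    | zero => simp
    | succ n ih =>
      rw [ascPochhammer_succ_eval,
        ← ih (Ring.factorial_nsmul_multichoose_eq_ascPochhammer β n), risingCoeff_succ,
        Nat.factorial_succ]
      push_cast
      field_simp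
  rw [mul_left_cancel₀ (by positivity) h2]
  rcases n.even_or_odd with hn | hn <;> simp [hn.neg_one_pow]

/-- The Chu-Vandermonde identity for the coefficients of `(1 - z) ^ (-β)`. -/
lemma sum_risingCoeff_mul_risingCoeff (β γ : ℝ) (n : ℕ) :
    ∑ k ∈ Finset.range (n + 1), risingCoeff β k * risingCoeff γ (n - k)
      = risingCoeff (β + γ) n := by
  rw [risingCoeff_eq_choose (β + γ), neg_add, Ring.add_choose_eq n (Commute.all _ _),
    Finset.Nat.sum_antidiagonal_eq_sum_range_succ_mk, Finset.mul_sum]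
  refine Finset.sum_congr rfl fun k hk => ?_
  have hk' : k ≤ n := Nat.lt_succ_iff.mp (Finset.mem_range.mp hk)
  rw [risingCoeff_eq_choose β, risingCoeff_eq_choose γ]
  nth_rewrite 3 [← Nat.add_sub_cancel' hk']
  rw [pow_add]
  ring

lemma risingCoeff_neg_succ_nonpos {α : ℝ} (hα : 0 ≤ α) (hα1 : α ≤ 1) (n : ℕ) :
    risingCoeff (-α) (n + 1) ≤ 0 := by
  rw [risingCoeff, Finset.prod_range_succ']
  refine mul_nonpos_of_nonneg_of_nonpos (Finset.prod_nonneg fun i _ => ?_) (by simpa using hα)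
  have : (0 : ℝ) ≤ i := i.cast_nonneg
  push_cast
  exact div_nonneg (by linarith) (by linarith)

lemma risingCoeff_add_one_le_pow {β : ℝ} (hβ : 0 ≤ β) (n : ℕ) :
    risingCoeff (β + 1) n ≤ (1 + β) ^ n := by
  refine (Finset.prod_le_prod (g := fun _ => 1 + β) (fun i _ => by positivity)
    fun i _ => ?_).trans_eq (by simp)
  rw [div_le_iff₀ (by positivity)]
  nlinarith [mul_nonneg hβ (i.cast_nonneg (α := ℝ))]

lemma one_add_div_le_rpow {β x : ℝ} (hβ : 0 ≤ β) (hx : 0 < x) :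
    1 + β / (x + 1) ≤ ((x + 1) / x) ^ β := by
  have h : 1 / (x + 1) ≤ Real.log ((x + 1) / x) := by
    have := Real.one_sub_inv_le_log_of_pos (show 0 < (x + 1) / x by positivity)
    refine le_trans (le_of_eq ?_) this
    field_simp
    ring
  rw [Real.rpow_def_of_pos (by positivity)]
  have h2 : β / (x + 1) ≤ Real.log ((x + 1) / x) * β := by
    calc β / (x + 1) = 1 / (x + 1) * β := by ring
      _ ≤ _ := by gcongr
  linarith [Real.add_one_le_exp (Real.log ((x + 1) / x) * β)]

lemma risingCoeff_add_one_le {β : ℝ} (hβ : 0 ≤ β) {M n : ℕ} (hM : 0 < M) (hn : M ≤ n) :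
    risingCoeff (β + 1) n ≤ (1 + β) ^ M * ((n : ℝ) / M) ^ β := by
  induction n, hn using Nat.le_induction with
  | base =>
    have : (M : ℝ) ≠ 0 := by positivity
    simpa [this] using risingCoeff_add_one_le_pow hβ M
  | succ n hn ih =>
    have hn0 : (0 : ℝ) < n := by exact_mod_cast hM.trans_le hn
    have hM0 : (0 : ℝ) < M := by exact_mod_cast hM
    have h1 : (β + 1 + n) / (n + 1) = 1 + β / ((n : ℝ) + 1) := by
      field_simp
      ring
    have h2 : (((n + 1 : ℕ) : ℝ) / M) ^ β = ((n : ℝ) / M) ^ β * (((n : ℝ) + 1) / n) ^ β := by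
      rw [← Real.mul_rpow (by positivity) (by positivity)]
      congr 1
      push_cast
      field_simp
    rw [risingCoeff_succ, h1, h2, ← mul_assoc]
    exact mul_le_mul ih (one_add_div_le_rpow hβ hn0) (by positivity) (by positivity)

/-- A form of Euler's limit formula for the reciprocal of the Gamma function. -/
lemma tendsto_risingCoeff_div_rpow {β : ℝ} (hβ : 0 ≤ β) :
    Tendsto (fun n : ℕ => risingCoeff (β + 1) n / (n : ℝ) ^ β) atTop
      (𝓝 (Real.Gamma (β + 1))⁻¹) := by
  have h1 := (Real.GammaSeq_tendsto_Gamma (β + 1)).inv₀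
    (Real.Gamma_pos_of_pos (by linarith)).ne'
  have h2 := tendsto_natCast_div_add_atTop (β + 1)
  have h := h2.mul h1
  rw [one_mul] at h
  refine h.congr' ?_
  filter_upwards [eventually_gt_atTop 0] with n hn
  have hn0 : (0 : ℝ) < n := by exact_mod_cast hn
  have h3 : ∏ j ∈ Finset.range n, (β + 1 + (j : ℝ)) ≠ 0 :=
    (Finset.prod_pos fun j _ => by positivity).ne'
  have h4 : risingCoeff (β + 1) n
      = (∏ j ∈ Finset.range n, (β + 1 + (j : ℝ))) / n.factorial := by
    rw [risingCoeff, Finset.prod_div_distrib, ← Finset.prod_range_add_one_eq_factorial]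
    push_cast
    rfl
  have h5 : β + 1 + (n : ℝ) ≠ 0 := by positivity
  have h6 : (n : ℝ) ^ β ≠ 0 := by positivity
  rw [h4, Real.GammaSeq, Finset.prod_range_succ, Real.rpow_add_one hn0.ne', add_comm (n : ℝ)]
  field_simp

/-- A discrete analogue of the Mittag-Leffler function: the coefficient of `z ^ n` in
`(1 - z) ^ (α - 1) / ((1 - z) ^ α - s)`. -/
noncomputable def discreteMittagLeffler (α : ℝ) (n : ℕ) (s : ℝ) : ℝ :=
  ∑' j : ℕ, s ^ j * risingCoeff (j * α + 1) n

lemma summable_one_add_mul_pow_mul_geometric {α : ℝ} (hα : 0 ≤ α) (hα1 : α ≤ 1) (M : ℕ) {r : ℝ}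
    (hr0 : 0 ≤ r) (hr : r < 1) : Summable fun j : ℕ => (1 + j * α) ^ M * r ^ j := by
  rcases hr0.eq_or_lt with rfl | hr0
  · refine summable_of_ne_finset_zero (s := {0}) fun j hj => ?_
    simp only [Finset.mem_singleton] at hj
    simp [hj]
  have h := summable_pow_mul_geometric_of_norm_lt_one M
    (r := r) (by rwa [Real.norm_of_nonneg hr0.le])
  have h' := ((summable_nat_add_iff 1).2 h).mul_left r⁻¹
  refine Summable.of_nonneg_of_le (fun j => by positivity) (fun j => ?_) h'
  have h2 : r⁻¹ * (((j + 1 : ℕ) : ℝ) ^ M * r ^ (j + 1)) = (1 + (j : ℝ)) ^ M * r ^ j := by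
    push_cast
    field_simp
    ring
  rw [h2]
  gcongr
  exact mul_le_of_le_one_right (by positivity) hα1

lemma summable_discreteMittagLeffler {α : ℝ} (hα : 0 ≤ α) (hα1 : α ≤ 1) (n : ℕ) {s : ℝ}
    (hs : |s| < 1) : Summable fun j : ℕ => s ^ j * risingCoeff (j * α + 1) n := by
  refine Summable.of_norm_bounded
    (summable_one_add_mul_pow_mul_geometric hα hα1 n (abs_nonneg s) hs) fun j => ?_
  have hj : 0 ≤ (j : ℝ) * α := by positivity
  rw [norm_mul, norm_pow, Real.norm_eq_abs, mul_comm,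
    Real.norm_of_nonneg (risingCoeff_nonneg (by linarith) n)]
  gcongr
  exact risingCoeff_add_one_le_pow hj n

lemma sum_risingCoeff_mul_discreteMittagLeffler {α : ℝ} (hα : 0 ≤ α) (hα1 : α ≤ 1) (n : ℕ)
    {s : ℝ} (hs : |s| < 1) :
    ∑ k ∈ Finset.range (n + 1), risingCoeff (-α) k * discreteMittagLeffler α (n - k) s
      = risingCoeff (1 - α) n + s * discreteMittagLeffler α n s := by
  have h1 : ∀ k ∈ Finset.range (n + 1), Summable fun j : ℕ =>
      risingCoeff (-α) k * (s ^ j * risingCoeff (j * α + 1) (n - k)) := fun k _ =>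
    (summable_discreteMittagLeffler hα hα1 _ hs).mul_left _
  have h2 : ∀ j : ℕ, ∑ k ∈ Finset.range (n + 1),
      risingCoeff (-α) k * (s ^ j * risingCoeff (j * α + 1) (n - k))
        = s ^ j * risingCoeff (-α + (j * α + 1)) n := fun j => by
    rw [← sum_risingCoeff_mul_risingCoeff, Finset.mul_sum]
    exact Finset.sum_congr rfl fun k _ => by ring
  have h3 := summable_sum h1
  simp_rw [discreteMittagLeffler, ← tsum_mul_left]
  rw [← Summable.tsum_finsetSum h1]
  simp_rw [h2] at h3 ⊢
  rw [h3.tsum_eq_zero_add]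
  congr 1
  · norm_num
    ring_nf
  · refine tsum_congr fun j => ?_
    push_cast
    rw [pow_succ']
    ring_nf

lemma discreteMittagLeffler_eq {α : ℝ} (hα : 0 ≤ α) (hα1 : α ≤ 1) (n : ℕ) {s : ℝ}
    (hs : |s| < 1) :
    discreteMittagLeffler α n s = (1 - s)⁻¹ * (risingCoeff (1 - α) n +
      ∑ k ∈ Finset.range n, -risingCoeff (-α) (k + 1) *
        discreteMittagLeffler α (n - (k + 1)) s) := by
  have h := sum_risingCoeff_mul_discreteMittagLeffler hα hα1 n hs
  rw [Finset.sum_range_succ'] at h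
  have h1 : 1 - s ≠ 0 := by linarith [(abs_lt.1 hs).2]
  simp only [neg_mul, Finset.sum_neg_distrib]
  simp only [risingCoeff_zero_right, one_mul, Nat.sub_zero] at h
  rw [eq_inv_mul_iff_mul_eq₀ h1]
  linarith

lemma discreteMittagLeffler_nonneg_monotoneOn_convexOn {α : ℝ} (hα : 0 ≤ α) (hα1 : α ≤ 1)
    (n : ℕ) :
    (∀ s ∈ Set.Ioo (-1 : ℝ) 1, 0 ≤ discreteMittagLeffler α n s) ∧
      MonotoneOn (discreteMittagLeffler α n) (Set.Ioo (-1) 1) ∧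
      ConvexOn ℝ (Set.Ioo (-1) 1) (discreteMittagLeffler α n) := by
  induction n using Nat.strong_induction_on with
  | _ n ih =>
  set S := Set.Ioo (-1 : ℝ) 1
  set g : ℝ → ℝ := fun s => risingCoeff (1 - α) n + ∑ k ∈ Finset.range n,
    -risingCoeff (-α) (k + 1) * discreteMittagLeffler α (n - (k + 1)) s with hg
  have heq : Set.EqOn ((fun s : ℝ => (1 - s)⁻¹) * g) (discreteMittagLeffler α n) S := fun s hs =>
    (discreteMittagLeffler_eq hα hα1 n (abs_lt.2 hs)).symm
  have hc : ∀ k, 0 ≤ -risingCoeff (-α) (k + 1) := fun k =>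
    neg_nonneg.2 (risingCoeff_neg_succ_nonpos hα hα1 k)
  have hlt : ∀ k ∈ Finset.range n, n - (k + 1) < n := fun k hk => by
    have := Finset.mem_range.1 hk
    lia
  have ha : 0 ≤ risingCoeff (1 - α) n := risingCoeff_nonneg (by linarith) n
  have hS : Convex ℝ S := convex_Ioo _ _
  have hg0 : ∀ ⦃s⦄, s ∈ S → 0 ≤ g s := fun s hs =>
    add_nonneg ha (Finset.sum_nonneg fun k hk => mul_nonneg (hc k) ((ih _ (hlt k hk)).1 s hs))
  have hgm : MonotoneOn g S := fun s hs t ht hst =>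
    add_le_add_right (Finset.sum_le_sum fun k hk =>
      mul_le_mul_of_nonneg_left ((ih _ (hlt k hk)).2.1 hs ht hst) (hc k)) _
  have hgc : ConvexOn ℝ S g := by
    refine ⟨hS, fun x hx y hy a b ha hb hab => ?_⟩
    have h1 : ∑ k ∈ Finset.range n,
        -risingCoeff (-α) (k + 1) * discreteMittagLeffler α (n - (k + 1)) (a • x + b • y) ≤
        ∑ k ∈ Finset.range n, -risingCoeff (-α) (k + 1) *
          (a • discreteMittagLeffler α (n - (k + 1)) x
            + b • discreteMittagLeffler α (n - (k + 1)) y) :=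
      Finset.sum_le_sum fun k hk =>
        mul_le_mul_of_nonneg_left ((ih _ (hlt k hk)).2.2.2 hx hy ha hb hab) (hc k)
    simp only [hg]
    refine (add_le_add_right h1 _).trans_eq ?_
    simp only [smul_eq_mul, mul_add, Finset.sum_add_distrib, Finset.mul_sum]
    have h2 : risingCoeff (1 - α) n
        = a * risingCoeff (1 - α) n + b * risingCoeff (1 - α) n := by
      rw [← add_mul, hab, one_mul]
    simp only [mul_left_comm a, mul_left_comm b]
    linear_combination h2
  have hi0 : ∀ ⦃s : ℝ⦄, s ∈ S → 0 ≤ (1 - s)⁻¹ := fun s hs =>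
    inv_nonneg.2 (by linarith [hs.2])
  have him : MonotoneOn (fun s : ℝ => (1 - s)⁻¹) S := fun s hs t ht hst =>
    inv_anti₀ (by linarith [ht.2]) (by linarith)
  have hic : ConvexOn ℝ S fun s : ℝ => (1 - s)⁻¹ := by
    refine ⟨hS, fun x hx y hy a b ha hb hab => ?_⟩
    have h := (convexOn_zpow (𝕜 := ℝ) (-1)).2 (x := 1 - x) (y := 1 - y) (sub_pos.2 hx.2)
      (sub_pos.2 hy.2) ha hb hab
    simp only [zpow_neg_one] at h
    refine le_trans (le_of_eq ?_) h
    simp only [smul_eq_mul]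
    congr 1
    linear_combination -hab
  refine ⟨fun s hs => ?_, fun s hs t ht hst => ?_, ?_⟩
  · rw [← heq hs]
    exact mul_nonneg (hi0 hs) (hg0 hs)
  · rw [← heq hs, ← heq ht]
    exact mul_le_mul (him hs ht hst) (hgm hs ht hst) (hg0 hs) (hi0 ht)
  · exact (hic.mul hgc hi0 hg0 (him.monovaryOn hgm)).congr heq

lemma exists_pos_mul_rpow_neg_lt_one {α : ℝ} (hα : 0 < α) (t : ℝ) :
    ∃ M : ℕ, 0 < M ∧ ∀ n : ℕ, M ≤ n → |t| * (n : ℝ) ^ (-α) < 1 := by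
  have h : Tendsto (fun n : ℕ => |t| * (n : ℝ) ^ (-α)) atTop (𝓝 0) := by
    simpa using ((tendsto_rpow_neg_atTop hα).comp tendsto_natCast_atTop_atTop).const_mul |t|
  obtain ⟨M, hM⟩ := eventually_atTop.1
    ((h.eventually_lt_const one_pos).and (eventually_gt_atTop 0))
  exact ⟨M, (hM M le_rfl).2, fun n hn => (hM n hn).1⟩

lemma risingCoeff_div_rpow_le {α : ℝ} (hα : 0 ≤ α) {M n : ℕ} (hM : 0 < M) (hn : M ≤ n) (j : ℕ) :
    risingCoeff (j * α + 1) n / (n : ℝ) ^ (j * α) ≤ (1 + j * α) ^ M * ((M : ℝ) ^ (-α)) ^ j := by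
  have hn0 : (0 : ℝ) < n := by exact_mod_cast hM.trans_le hn
  rw [div_le_iff₀ (by positivity)]
  refine (risingCoeff_add_one_le (by positivity) hM hn).trans_eq ?_
  rw [Real.div_rpow (by positivity) (by positivity), ← Real.rpow_mul_natCast (by positivity),
    mul_assoc, show -α * (j : ℝ) = -(j * α) by ring, Real.rpow_neg (by positivity)]
  ring

lemma inv_Gamma_le {α : ℝ} (hα : 0 ≤ α) {M : ℕ} (hM : 0 < M) (j : ℕ) :
    (Real.Gamma (j * α + 1))⁻¹ ≤ (1 + j * α) ^ M * ((M : ℝ) ^ (-α)) ^ j :=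
  le_of_tendsto (tendsto_risingCoeff_div_rpow (by positivity)) <| by
    filter_upwards [eventually_ge_atTop M] with n hn
    exact risingCoeff_div_rpow_le hα hM hn j

lemma summable_abs_pow_mul_inv_Gamma {α : ℝ} (hα : 0 < α) (hα1 : α ≤ 1) (t : ℝ) :
    Summable fun j : ℕ => (Real.Gamma (j * α + 1))⁻¹ * |t| ^ j := by
  obtain ⟨M, hM, hMt⟩ := exists_pos_mul_rpow_neg_lt_one hα t
  refine Summable.of_nonneg_of_le (fun j => ?_) (fun j => ?_)
    (summable_one_add_mul_pow_mul_geometric hα.le hα1 M (by positivity) (hMt M le_rfl))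
  · have := Real.Gamma_pos_of_pos (show 0 < j * α + 1 by positivity)
    positivity
  · rw [mul_pow, mul_left_comm, mul_comm _ (|t| ^ j)]
    gcongr
    exact inv_Gamma_le hα.le hM j

lemma tendsto_discreteMittagLeffler {α : ℝ} (hα : 0 < α) (hα1 : α ≤ 1) (t : ℝ) :
    Tendsto (fun n : ℕ => discreteMittagLeffler α n (t * (n : ℝ) ^ (-α))) atTop
      (𝓝 (mittagLeffler α t)) := by
  obtain ⟨M, hM, hMt⟩ := exists_pos_mul_rpow_neg_lt_one hα t
  have heq : ∀ n j : ℕ, (t * (n : ℝ) ^ (-α)) ^ j * risingCoeff (j * α + 1) n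
      = t ^ j * (risingCoeff (j * α + 1) n / (n : ℝ) ^ (j * α)) := fun n j => by
    rw [mul_pow, ← Real.rpow_mul_natCast (by positivity),
      show -α * (j : ℝ) = -(j * α) by ring, Real.rpow_neg (by positivity)]
    ring
  simp only [discreteMittagLeffler, mittagLeffler, heq, div_eq_mul_inv (t ^ _)]
  refine tendsto_tsum_of_dominated_convergence
    (summable_one_add_mul_pow_mul_geometric hα.le hα1 M (by positivity) (hMt M le_rfl))
    (fun j => (tendsto_risingCoeff_div_rpow (by positivity)).const_mul _) ?_
  filter_upwards [eventually_ge_atTop M] with n hn j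
  have h0 : 0 ≤ risingCoeff (j * α + 1) n / (n : ℝ) ^ (j * α) :=
    div_nonneg (risingCoeff_nonneg (by positivity) n) (by positivity)
  rw [norm_mul, norm_pow, Real.norm_eq_abs, Real.norm_of_nonneg h0, mul_pow, mul_left_comm]
  gcongr
  exact risingCoeff_div_rpow_le hα.le hM hn j

lemma eventually_mul_rpow_neg_mem_Ioo {α : ℝ} (hα : 0 < α) (t : ℝ) :
    ∀ᶠ n : ℕ in atTop, t * (n : ℝ) ^ (-α) ∈ Set.Ioo (-1 : ℝ) 1 := by
  obtain ⟨M, -, hMt⟩ := exists_pos_mul_rpow_neg_lt_one hα t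
  filter_upwards [eventually_ge_atTop M] with n hn
  refine abs_lt.1 ?_
  rw [abs_mul, abs_of_nonneg (a := (n : ℝ) ^ (-α)) (by positivity)]
  exact hMt n hn

lemma monotone_mittagLeffler {α : ℝ} (hα : 0 < α) (hα1 : α ≤ 1) :
    Monotone (mittagLeffler α) := fun s t hst => by
  refine le_of_tendsto_of_tendsto (tendsto_discreteMittagLeffler hα hα1 s)
    (tendsto_discreteMittagLeffler hα hα1 t) ?_
  filter_upwards [eventually_mul_rpow_neg_mem_Ioo hα s, eventually_mul_rpow_neg_mem_Ioo hα t]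
    with n hs ht
  exact (discreteMittagLeffler_nonneg_monotoneOn_convexOn hα.le hα1 n).2.1 hs ht (by gcongr)

lemma convexOn_mittagLeffler {α : ℝ} (hα : 0 < α) (hα1 : α ≤ 1) :
    ConvexOn ℝ Set.univ (mittagLeffler α) := by
  refine ⟨convex_univ, fun x _ y _ a b ha hb hab => ?_⟩
  refine le_of_tendsto_of_tendsto (tendsto_discreteMittagLeffler hα hα1 (a • x + b • y))
    (((tendsto_discreteMittagLeffler hα hα1 x).const_smul a).add
      ((tendsto_discreteMittagLeffler hα hα1 y).const_smul b)) ?_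
  filter_upwards [eventually_mul_rpow_neg_mem_Ioo hα x, eventually_mul_rpow_neg_mem_Ioo hα y]
    with n hx hy
  have h := (discreteMittagLeffler_nonneg_monotoneOn_convexOn hα.le hα1 n).2.2.2 hx hy ha hb hab
  simp only [smul_eq_mul] at h ⊢
  rwa [add_mul, mul_assoc, mul_assoc]

lemma hasFPowerSeriesOnBall_mittagLeffler {α : ℝ} (hα : 0 < α) (hα1 : α ≤ 1) :
    HasFPowerSeriesOnBall (mittagLeffler α)
      (FormalMultilinearSeries.ofScalars ℝ fun j : ℕ => (Real.Gamma (j * α + 1))⁻¹) 0 ⊤ := by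
  set p := FormalMultilinearSeries.ofScalars ℝ fun j : ℕ => (Real.Gamma (j * α + 1))⁻¹ with hp
  have hr : p.radius = ⊤ := p.radius_eq_top_of_summable_norm fun r => by
    refine (summable_abs_pow_mul_inv_Gamma hα hα1 r).congr fun j => ?_
    have := Real.Gamma_pos_of_pos (show 0 < j * α + 1 by positivity)
    rw [hp, FormalMultilinearSeries.ofScalars_norm, Real.norm_of_nonneg (by positivity),
      NNReal.abs_eq]
  have h := p.hasFPowerSeriesOnBall (by simp [hr])
  have hsum : p.sum = mittagLeffler α := by
    ext t
    refine (FormalMultilinearSeries.ofScalars_sum_eq _ t).trans (tsum_congr fun j => ?_)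
    rw [smul_eq_mul, div_eq_inv_mul]
  rwa [hr, hsum] at h

/-- For `0 < α ≤ 1`, the derivative of the Mittag-Leffler function is everywhere
positive; in particular `E_α` is strictly increasing on `ℝ`. -/
theorem mittagLeffler_deriv_pos (α : ℝ) (hα : 0 < α) (hα1 : α ≤ 1) :
    (∀ t : ℝ, 0 < deriv (mittagLeffler α) t) ∧ StrictMono (mittagLeffler α) := by
  suffices h : ∀ t : ℝ, 0 < deriv (mittagLeffler α) t from ⟨h, strictMono_of_deriv_pos h⟩
  have hps := hasFPowerSeriesOnBall_mittagLeffler hα hα1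
  have han : AnalyticOnNhd ℝ (mittagLeffler α) Set.univ := fun t _ =>
    hps.analyticAt_of_mem (by simp)
  have h0 : deriv (mittagLeffler α) 0 ≠ 0 := by
    rw [hps.hasFPowerSeriesAt.deriv, FormalMultilinearSeries.ofScalars_apply_eq]
    have := Real.Gamma_pos_of_pos (show 0 < ((1 : ℕ) : ℝ) * α + 1 by positivity)
    simpa using (inv_pos.2 this).ne'
  have hmono : MonotoneOn (deriv (mittagLeffler α)) Set.univ :=
    (convexOn_mittagLeffler hα hα1).monotoneOn_deriv fun t ht => (han t ht).differentiableAt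
  have hnn : ∀ t, 0 ≤ deriv (mittagLeffler α) t := fun t =>
    (monotone_mittagLeffler hα hα1).deriv_nonneg
  intro t
  refine (hnn t).lt_of_ne' fun ht => h0 ?_
  have hev : deriv (mittagLeffler α) =ᶠ[𝓝 (t - 1)] 0 := by
    filter_upwards [Iio_mem_nhds (sub_one_lt t)] with s hs
    exact ((hmono trivial trivial (le_of_lt hs)).trans_eq ht).antisymm (hnn s)
  exact han.deriv.eqOn_zero_of_preconnected_of_eventuallyEq_zero isPreconnected_univ
    trivial hev trivial
end
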